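/- Let φ_n and φ be normal completely positive maps on B(K). The following are equivalent: (i) {φ_n} is uniformly bounded and ‖φ_n − φ‖_D → 0; (ii) {φ_n} is uniformly bounded, ‖D_{φ_n}‖_{T(H)} → ‖D_φ‖_{T(H)}, and D_{φ_n} → D_φ weakly; (iii) φ_n → φ in the point-weak* topology. -/

import Mathlib

set_option synthInstance.maxHeartbeats 1000000
set_option maxHeartbeats 1000000

noncomputable section

open scoped InnerProductSpace ComplexOrder
open ContinuousLinearMap

local notation "⟪" x ", " y "⟫" => @inner ℂ _ _ x y

namespace ChoiInf

variable {H : Type*} [NormedAddCommGroup H] [InnerProductSpace ℂ H] [CompleteSpace H]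

/-- The rank one operator `x ⊠ y : z ↦ (z|y)·x = ⟪y, z⟫ • x`
(inner products written with Mathlib's convention: conjugate linear in the
first variable, so that the paper's `(z|y)` is `⟪y, z⟫`). -/
def rankOne (x y : H) : H →L[ℂ] H := (innerSL ℂ y).smulRight x

/-- The trace of an operator, computed relative to a Hilbert basis:
`Tr X = Σᵢ (X eᵢ | eᵢ) = Σᵢ ⟪eᵢ, X eᵢ⟫`.  (For trace class operators this does
not depend on the choice of basis.) -/
def tr {ι : Type*} (b : HilbertBasis ι ℂ H) (T : H →L[ℂ] H) : ℂ :=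
  ∑' i, ⟪b i, T (b i)⟫

/-- The bilinear pairing `⟨A, B⟩ = Tr (A B)` between `B(H)` and `T(H)`. -/
def pairing {ι : Type*} (b : HilbertBasis ι ℂ H) (A T : H →L[ℂ] H) : ℂ :=
  tr b (A ∘L T)

/-- Trace class operators, characterized by nuclear representations
`T = Σₙ xₙ ⊠ yₙ` with `Σₙ ‖xₙ‖‖yₙ‖ < ∞`. -/
def IsTraceClass (T : H →L[ℂ] H) : Prop :=
  ∃ x y : ℕ → H, Summable (fun n => ‖x n‖ * ‖y n‖) ∧
    ∀ z, T z = ∑' n, ⟪y n, z⟫ • x n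

/-- The trace norm, as the infimum of `Σₙ ‖xₙ‖‖yₙ‖` over all nuclear
representations `T = Σₙ xₙ ⊠ yₙ`. -/
def traceNorm (T : H →L[ℂ] H) : ℝ :=
  sInf {c : ℝ | ∃ x y : ℕ → H, HasSum (fun n => ‖x n‖ * ‖y n‖) c ∧
    ∀ z, T z = ∑' n, ⟪y n, z⟫ • x n}

/-- `(Φ, Φst)` is a dual pair:  `Φst` preserves the trace class and
`⟨Φ A, T⟩ = ⟨A, Φst T⟩` for all trace class `T`.  A linear map `Φ` on `B(H)` is
normal (σ-weakly continuous) precisely when it admits such a predual map `Φst`. -/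
def IsNormalPair {ι : Type*} (b : HilbertBasis ι ℂ H)
    (Φ Φst : (H →L[ℂ] H) →ₗ[ℂ] (H →L[ℂ] H)) : Prop :=
  (∀ T, IsTraceClass T → IsTraceClass (Φst T)) ∧
    ∀ A T, IsTraceClass T → pairing b (Φ A) T = pairing b A (Φst T)

/-- Positivity of a `k × k` matrix of operators, i.e. positivity of the
corresponding operator on `H ⊕ ⋯ ⊕ H`. -/
def MatPos {k : ℕ} (A : Fin k → Fin k → (H →L[ℂ] H)) : Prop :=
  ∀ v : Fin k → H, 0 ≤ ∑ i, ∑ j, ⟪v i, A i j (v j)⟫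

/-- The operator on `H ⊕ ⋯ ⊕ H` given by a `k × k` matrix of operators has norm `≤ c`. -/
def matNormLe {k : ℕ} (A : Fin k → Fin k → (H →L[ℂ] H)) (c : ℝ) : Prop :=
  ∀ v w : Fin k → H,
    ‖∑ i, ∑ j, ⟪w i, A i j (v j)⟫‖ ≤
      c * Real.sqrt (∑ i, ‖v i‖ ^ 2) * Real.sqrt (∑ i, ‖w i‖ ^ 2)

/-- A von Neumann algebra is a factor when its center consists of the scalars. -/
def IsFactor (M : VonNeumannAlgebra H) : Prop :=
  ∀ T ∈ M, T ∈ M.commutant → ∃ c : ℂ, T = c • (1 : H →L[ℂ] H)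

/-- `x0` is a cyclic vector for `M`. -/
def Cyclic (M : VonNeumannAlgebra H) (x0 : H) : Prop :=
  Dense {y : H | ∃ A ∈ M, A x0 = y}

/-- `x0` is a separating vector for `M`. -/
def Separating (M : VonNeumannAlgebra H) (x0 : H) : Prop :=
  ∀ A ∈ M, A x0 = 0 → A = 0

/-- `Φ` restricts on `alg(M', M)` to the map `φ̃ : A'B ↦ A'·φ(B)`.
(Maps `φ : M → M` are encoded as linear maps on `B(H)` sending `M` into `M`;
only the restriction to `M` is relevant.) -/
def ExtendsTilde (M : VonNeumannAlgebra H)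
    (φ Φ : (H →L[ℂ] H) →ₗ[ℂ] (H →L[ℂ] H)) : Prop :=
  ∀ A' ∈ M.commutant, ∀ B ∈ M, Φ (A' * B) = A' * φ B

/-- The space `CB^σ_ε(M)` of maps `φ : M → M` such that `φ̃` extends to a normal
map on `B(H)`. -/
def CBSigmaE {ι : Type*} (b : HilbertBasis ι ℂ H) (M : VonNeumannAlgebra H) :
    Set ((H →L[ℂ] H) →ₗ[ℂ] (H →L[ℂ] H)) :=
  {φ | (∀ B ∈ M, φ B ∈ M) ∧
    ∃ Φ Φst, ExtendsTilde M φ Φ ∧ IsNormalPair b Φ Φst}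

/-- `φ` is completely positive as a map on `M`. -/
def IsCPOn (M : VonNeumannAlgebra H) (φ : (H →L[ℂ] H) →ₗ[ℂ] (H →L[ℂ] H)) : Prop :=
  ∀ (k : ℕ) (A : Fin k → Fin k → (H →L[ℂ] H)), (∀ i j, A i j ∈ M) →
    MatPos A → MatPos fun i j => φ (A i j)

/-- `φ` is completely positive (on all of `B(H)`). -/
def IsCPFull (φ : (H →L[ℂ] H) →ₗ[ℂ] (H →L[ℂ] H)) : Prop :=
  ∀ (k : ℕ) (A : Fin k → Fin k → (H →L[ℂ] H)), MatPos A → MatPos fun i j => φ (A i j)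

/-- `c` is a completely bounded bound for `φ` as a map on `M`. -/
def CBBoundOn (M : VonNeumannAlgebra H) (φ : (H →L[ℂ] H) →ₗ[ℂ] (H →L[ℂ] H))
    (c : ℝ) : Prop :=
  ∀ (k : ℕ) (A : Fin k → Fin k → (H →L[ℂ] H)), (∀ i j, A i j ∈ M) →
    matNormLe A 1 → matNormLe (fun i j => φ (A i j)) c

/-- The completely bounded norm of `φ` as a map on `M`. -/
def cbNormOn (M : VonNeumannAlgebra H) (φ : (H →L[ℂ] H) →ₗ[ℂ] (H →L[ℂ] H)) : ℝ :=
  sInf {c : ℝ | 0 ≤ c ∧ CBBoundOn M φ c}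

/-- `φ` is completely bounded as a map on `M`. -/
def IsCBOn (M : VonNeumannAlgebra H) (φ : (H →L[ℂ] H) →ₗ[ℂ] (H →L[ℂ] H)) : Prop :=
  ∃ c, 0 ≤ c ∧ CBBoundOn M φ c

/-- `φ` is normal as a map on `M`: every normal functional composed with `φ`
is again normal (i.e. implemented by a trace class operator). -/
def NormalOn {ι : Type*} (b : HilbertBasis ι ℂ H) (M : VonNeumannAlgebra H)
    (φ : (H →L[ℂ] H) →ₗ[ℂ] (H →L[ℂ] H)) : Prop :=
  ∀ T, IsTraceClass T → ∃ T', IsTraceClass T' ∧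
    ∀ A ∈ M, pairing b (φ A) T = pairing b A T'

/-- The map `Ad_V : X ↦ V* X V`. -/
def AdL (V : H →L[ℂ] H) : (H →L[ℂ] H) →ₗ[ℂ] (H →L[ℂ] H) where
  toFun X := star V * X * V
  map_add' X Y := by simp [add_mul, mul_add]
  map_smul' c X := by simp [smul_mul_assoc, mul_smul_comm]

/-- `p` is a minimal (nonzero) projection in `M`. -/
def IsMinimalProjection (M : VonNeumannAlgebra H) (p : H →L[ℂ] H) : Prop :=
  p ∈ M ∧ IsIdempotentElem p ∧ IsSelfAdjoint p ∧ p ≠ 0 ∧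
    ∀ q, q ∈ M → IsIdempotentElem q → IsSelfAdjoint q → q ≠ 0 →
      q * p = q → p * q = q → q = p

/-- A factor is of type I precisely when it contains a minimal projection. -/
def IsTypeI (M : VonNeumannAlgebra H) : Prop :=
  ∃ p, IsMinimalProjection M p

variable {K : Type*} [NormedAddCommGroup K] [InnerProductSpace ℂ K] [CompleteSpace K]

/-- `T` is a Hilbert–Schmidt operator (relative to a Hilbert basis `e`;
this does not depend on the choice of `e`). -/
def IsHS {ι : Type*} (e : HilbertBasis ι ℂ K) (T : K →L[ℂ] K) : Prop :=
  Summable fun i => ‖T (e i)‖ ^ 2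

/-- A model of the Hilbert space `HS(K)` of Hilbert–Schmidt operators on `K`,
with `B(K)` acting by left multiplications `Lmul` and right multiplications
`Rmul`.  `toOp` regards a vector of `H` as an operator on `K`; its range is
exactly the set of Hilbert–Schmidt operators, and the inner product of `H` is
`(x|y) = Tr (x y*)`, i.e. `⟪x, y⟫ = Σᵢ ⟪x eᵢ, y eᵢ⟫`. -/
structure HSModel {ι : Type*} (e : HilbertBasis ι ℂ K) (H : Type*)
    [NormedAddCommGroup H] [InnerProductSpace ℂ H] [CompleteSpace H] where
  toOp : H →ₗ[ℂ] (K →L[ℂ] K)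
  inj : Function.Injective toOp
  mem_range : ∀ T : K →L[ℂ] K, IsHS e T ↔ ∃ x : H, toOp x = T
  inner_eq : ∀ x y : H, ⟪x, y⟫ = ∑' i, ⟪toOp x (e i), toOp y (e i)⟫
  Lmul : (K →L[ℂ] K) → (H →L[ℂ] H)
  Lmul_eq : ∀ a x, toOp (Lmul a x) = a ∘L toOp x
  Rmul : (K →L[ℂ] K) → (H →L[ℂ] H)
  Rmul_eq : ∀ a x, toOp (Rmul a x) = toOp x ∘L a

/-- The operator `T` has rank at most `k`. -/
def rankLE (T : K →L[ℂ] K) (k : ℕ) : Prop :=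
  Module.rank ℂ (LinearMap.range (T : K →ₗ[ℂ] K)) ≤ (k : Cardinal)

variable {H : Type*} [NormedAddCommGroup H] [InnerProductSpace ℂ H] [CompleteSpace H]
  {ι : Type*} {e : HilbertBasis ι ℂ K}

/-- `Φ` restricts to the map `φ̃ : R_y L_x ↦ R_y L_{φ(x)}` on `alg(M', M)` for
`M = L_{B(K)}`. -/
def HSExt (m : HSModel e H) (φ : (K →L[ℂ] K) →ₗ[ℂ] (K →L[ℂ] K))
    (Φ : (H →L[ℂ] H) →ₗ[ℂ] (H →L[ℂ] H)) : Prop :=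
  ∀ a x : K →L[ℂ] K, Φ (m.Rmul a ∘L m.Lmul x) = m.Rmul a ∘L m.Lmul (φ x)

/-- `φ` is `k`-positive. -/
def kPos (k : ℕ) (φ : (K →L[ℂ] K) →ₗ[ℂ] (K →L[ℂ] K)) : Prop :=
  ∀ A : Fin k → Fin k → (K →L[ℂ] K), MatPos A → MatPos fun i j => φ (A i j)

/-- `φ` is completely bounded (as a map on all of `B(K)`). -/
def IsCBFullK (φ : (K →L[ℂ] K) →ₗ[ℂ] (K →L[ℂ] K)) : Prop :=
  ∃ c, 0 ≤ c ∧ ∀ (k : ℕ) (A : Fin k → Fin k → (K →L[ℂ] K)),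
    matNormLe A 1 → matNormLe (fun i j => φ (A i j)) c

/-- `φ` belongs to `CB^σ(B(K))`: it is normal and completely bounded. -/
def NormalCB (e : HilbertBasis ι ℂ K) (φ : (K →L[ℂ] K) →ₗ[ℂ] (K →L[ℂ] K)) : Prop :=
  (∃ φst, IsNormalPair e φ φst) ∧ IsCBFullK φ

/-- The cone `𝒮_k` of `T(H)`: the trace-norm closed convex cone generated by
the `ω_{x,x} = x ⊠ x` with `rank x ≤ k` (rank as an operator on `K`). -/
def SchmidtCone (m : HSModel e H) (k : ℕ) : Set (H →L[ℂ] H) :=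
  {T | ∀ ε : ℝ, 0 < ε → ∃ (n : ℕ) (x : Fin n → H),
    (∀ i, rankLE (m.toOp (x i)) k) ∧
      traceNorm (T - ∑ i, rankOne (x i) (x i)) < ε}

/-- `ψ` belongs to the convex cone `𝔼_k` generated by the maps `Ad_V` with
`rank V ≤ k`. -/
def InEk (k : ℕ) (ψ : (K →L[ℂ] K) →ₗ[ℂ] (K →L[ℂ] K)) : Prop :=
  ∃ (n : ℕ) (V : Fin n → (K →L[ℂ] K)), (∀ i, rankLE (V i) k) ∧
    ∀ x, ψ x = ∑ i, star (V i) * x * V i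

/-- `φ` (with Choi trace-class operator `Dphi = D_φ`) is `k`-superpositive:
it lies in the `‖·‖_D`-closure of the cone `𝔼_k`, where `‖ψ‖_D = ‖D_ψ‖_{T(H)}`. -/
def kSuper {ιH : Type*} (bH : HilbertBasis ιH ℂ H) (m : HSModel e H) (x0 : H)
    (k : ℕ) (Dphi : H →L[ℂ] H) : Prop :=
  ∀ ε : ℝ, 0 < ε → ∃ ψ Ψ Ψst, InEk k ψ ∧ HSExt m ψ Ψ ∧ IsNormalPair bH Ψ Ψst ∧
    traceNorm (Dphi - Ψst (rankOne x0 x0)) < ε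

/-- `T` has a nuclear representation `T = Σₙ xₙ ⊠ yₙ` with `Σₙ ‖xₙ‖‖yₙ‖ = c`. -/
def HasNuclearRep {E : Type*} [NormedAddCommGroup E] [InnerProductSpace ℂ E]
    (T : E →L[ℂ] E) (c : ℝ) : Prop :=
  ∃ x y : ℕ → E, HasSum (fun n => ‖x n‖ * ‖y n‖) c ∧ ∀ z, T z = ∑' n, ⟪y n, z⟫ • x n

section Hilbert

variable {E : Type*} [NormedAddCommGroup E] [InnerProductSpace ℂ E]

theorem rankOne_apply (x y z : E) : rankOne x y z = ⟪y, z⟫ • x := by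
  simp [rankOne]

theorem summable_inner_smul [CompleteSpace E] {κ : Type*} {x y : κ → E}
    (h : Summable fun k => ‖x k‖ * ‖y k‖) (z : E) : Summable fun k => ⟪y k, z⟫ • x k := by
  refine Summable.of_norm_bounded (h.mul_right ‖z‖) fun k => ?_
  rw [norm_smul]
  calc ‖⟪y k, z⟫‖ * ‖x k‖ ≤ (‖y k‖ * ‖z‖) * ‖x k‖ := by
        gcongr; exact norm_inner_le_norm _ _
    _ = _ := by ring

theorem HasNuclearRep.of_hasSum {κ : Type*} {x y : κ → E} {c : ℝ} {T : E →L[ℂ] E}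
    (hc : HasSum (fun k => ‖x k‖ * ‖y k‖) c) (hT : ∀ z, T z = ∑' k, ⟪y k, z⟫ • x k) :
    HasNuclearRep T c := by
  classical
  set s : Set κ := Function.support fun k => ‖x k‖ * ‖y k‖ with hs
  have hcount : s.Countable := hc.summable.countable_support
  have : Countable s := hcount.to_subtype
  obtain ⟨f, hf⟩ := exists_injective_nat s
  have hzero : ∀ k, k ∉ s → x k = 0 ∨ y k = 0 := by
    intro k hk
    simpa [hs, or_iff_not_imp_left] using hk
  refine ⟨Function.extend f (fun k => x k) 0, Function.extend f (fun k => y k) 0, ?_, ?_⟩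
  · have h1 : HasSum (fun k : s => ‖x k‖ * ‖y k‖) c :=
      (hasSum_subtype_iff_of_support_subset (f := fun k => ‖x k‖ * ‖y k‖) subset_rfl).2 hc
    rw [← hasSum_extend_zero hf] at h1
    convert h1 using 2 with n
    by_cases hn : ∃ a, f a = n
    · obtain ⟨a, rfl⟩ := hn
      simp [hf.extend_apply]
    · simp [Function.extend_apply' _ _ _ hn]
  · intro z
    rw [hT z]
    have h2 : (∑' k, ⟪y k, z⟫ • x k) = ∑' k : s, ⟪y k, z⟫ • x k := by
      refine (tsum_subtype_eq_of_support_subset (f := fun k => ⟪y k, z⟫ • x k) ?_).symm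
      intro k hk
      by_contra hks
      rcases hzero k hks with h | h <;> simp [h] at hk
    rw [h2, ← tsum_extend_zero hf]
    congr 1
    funext n
    by_cases hn : ∃ a, f a = n
    · obtain ⟨a, rfl⟩ := hn
      simp [hf.extend_apply]
    · simp [Function.extend_apply' _ _ _ hn]

theorem HasNuclearRep.nonneg {T : E →L[ℂ] E} {c : ℝ} (h : HasNuclearRep T c) : 0 ≤ c := by
  obtain ⟨x, y, hc, -⟩ := h
  exact hc.nonneg fun n => by positivity

theorem HasNuclearRep.opNorm_le {T : E →L[ℂ] E} {c : ℝ} (h : HasNuclearRep T c) : ‖T‖ ≤ c := by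
  refine T.opNorm_le_bound h.nonneg fun z => ?_
  obtain ⟨x, y, hc, hT⟩ := h
  rw [hT]
  refine tsum_of_norm_bounded (hc.mul_right ‖z‖) fun n => ?_
  rw [norm_smul]
  calc ‖⟪y n, z⟫‖ * ‖x n‖ ≤ (‖y n‖ * ‖z‖) * ‖x n‖ := by
        gcongr; exact norm_inner_le_norm _ _
    _ = _ := by ring

theorem HasNuclearRep.neg {T : E →L[ℂ] E} {c : ℝ} (h : HasNuclearRep T c) :
    HasNuclearRep (-T) c := by
  obtain ⟨x, y, hc, hT⟩ := h
  refine ⟨fun n => -x n, y, by simpa using hc, fun z => ?_⟩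
  simp [hT z, tsum_neg]

theorem HasNuclearRep.add [CompleteSpace E] {T S : E →L[ℂ] E} {c d : ℝ}
    (hT : HasNuclearRep T c) (hS : HasNuclearRep S d) : HasNuclearRep (T + S) (c + d) := by
  obtain ⟨x, y, hc, hT⟩ := hT
  obtain ⟨u, v, hd, hS⟩ := hS
  refine HasNuclearRep.of_hasSum (κ := ℕ ⊕ ℕ) (x := Sum.elim x u) (y := Sum.elim y v) ?_ ?_
  · exact HasSum.sum (by simpa [Function.comp_def] using hc) (by simpa [Function.comp_def] using hd)
  · intro z
    rw [add_apply, hT, hS]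
    refine (HasSum.tsum_eq (HasSum.sum ?_ ?_)).symm
    · simpa [Function.comp_def] using (summable_inner_smul hc.summable z).hasSum
    · simpa [Function.comp_def] using (summable_inner_smul hd.summable z).hasSum

theorem HasNuclearRep.sub [CompleteSpace E] {T S : E →L[ℂ] E} {c d : ℝ}
    (hT : HasNuclearRep T c) (hS : HasNuclearRep S d) : HasNuclearRep (T - S) (c + d) := by
  rw [sub_eq_add_neg]
  exact hT.add hS.neg

theorem HasNuclearRep.rankOne (x y : E) : HasNuclearRep (rankOne x y) (‖x‖ * ‖y‖) :=
  .of_hasSum (κ := Unit) (x := fun _ => x) (y := fun _ => y)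
    (hasSum_unique fun _ : Unit => ‖x‖ * ‖y‖) fun z => by simp [rankOne_apply]

theorem isTraceClass_iff {T : E →L[ℂ] E} :
    IsTraceClass T ↔ ∃ c, HasNuclearRep T c :=
  ⟨fun ⟨x, y, h, hT⟩ => ⟨_, x, y, h.hasSum, hT⟩, fun ⟨_, x, y, h, hT⟩ => ⟨x, y, h.summable, hT⟩⟩

theorem traceNorm_nonneg (T : E →L[ℂ] E) : 0 ≤ traceNorm T :=
  Real.sInf_nonneg fun _ hc => HasNuclearRep.nonneg hc

theorem traceNorm_le {T : E →L[ℂ] E} {c : ℝ} (h : HasNuclearRep T c) :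
    traceNorm T ≤ c :=
  csInf_le ⟨0, fun _ hc => HasNuclearRep.nonneg hc⟩ h

theorem le_traceNorm {T : E →L[ℂ] E} (hT : IsTraceClass T) {a : ℝ}
    (h : ∀ c, HasNuclearRep T c → a ≤ c) : a ≤ traceNorm T :=
  le_csInf (isTraceClass_iff.1 hT) h

theorem IsTraceClass.sub [CompleteSpace E] {T S : E →L[ℂ] E} (hT : IsTraceClass T)
    (hS : IsTraceClass S) : IsTraceClass (T - S) := by
  obtain ⟨c, hc⟩ := isTraceClass_iff.1 hT
  obtain ⟨d, hd⟩ := isTraceClass_iff.1 hS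
  exact isTraceClass_iff.2 ⟨_, hc.sub hd⟩

theorem isTraceClass_rankOne (x y : E) : IsTraceClass (rankOne x y) :=
  isTraceClass_iff.2 ⟨_, .rankOne x y⟩

theorem traceNorm_add_le [CompleteSpace E] {T S : E →L[ℂ] E} (hT : IsTraceClass T)
    (hS : IsTraceClass S) : traceNorm (T + S) ≤ traceNorm T + traceNorm S := by
  rw [← sub_le_iff_le_add]
  refine le_traceNorm hT fun c hc => ?_
  rw [sub_le_iff_le_add, ← sub_le_iff_le_add']
  refine le_traceNorm hS fun d hd => ?_
  rw [sub_le_iff_le_add']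
  exact traceNorm_le (hc.add hd)

theorem traceNorm_neg (T : E →L[ℂ] E) : traceNorm (-T) = traceNorm T := by
  have : ∀ c, HasNuclearRep (-T) c ↔ HasNuclearRep T c := fun c =>
    ⟨fun h => by simpa using h.neg, fun h => h.neg⟩
  exact congrArg sInf (Set.ext this)

theorem abs_traceNorm_sub_le [CompleteSpace E] {T S : E →L[ℂ] E} (hT : IsTraceClass T)
    (hS : IsTraceClass S) : |traceNorm T - traceNorm S| ≤ traceNorm (T - S) := by
  rw [abs_le]
  constructor
  · have := traceNorm_add_le hT (hS.sub hT)
    rw [add_sub_cancel, ← traceNorm_neg (S - T), neg_sub] at this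
    linarith
  · have := traceNorm_add_le hS (hT.sub hS)
    rw [add_sub_cancel] at this
    linarith

theorem pairing_rankOne_right {κ : Type*} (b : HilbertBasis κ ℂ E) (A : E →L[ℂ] E) (u w : E) :
    pairing b A (rankOne u w) = ⟪w, A u⟫ := by
  rw [← b.tsum_inner_mul_inner w (A u)]
  simp [pairing, tr, rankOne_apply]

theorem tendsto_inner_of_dense_span {a : ℕ → E} {a₀ : E} {C : ℝ} (hC : ∀ n, ‖a n‖ ≤ C)
    {s : Set E} (hs : Dense (Submodule.span ℂ s : Set E))
    (h : ∀ v ∈ s, Filter.Tendsto (fun n => ⟪a n, v⟫) Filter.atTop (nhds ⟪a₀, v⟫)) (v : E) :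
    Filter.Tendsto (fun n => ⟪a n, v⟫) Filter.atTop (nhds ⟪a₀, v⟫) := by
  have hspan : ∀ v ∈ Submodule.span ℂ s,
      Filter.Tendsto (fun n => ⟪a n, v⟫) Filter.atTop (nhds ⟪a₀, v⟫) := by
    intro v hv
    induction hv using Submodule.span_induction with
    | mem v hv => exact h v hv
    | zero => simp
    | add v w _ _ hv hw => simpa only [inner_add_right] using hv.add hw
    | smul c v _ hv => simpa only [inner_smul_right] using hv.const_mul c
  rw [Metric.tendsto_atTop]
  intro ε hε
  have hC0 : 0 ≤ C := (norm_nonneg _).trans (hC 0)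
  have hM : 0 < C + ‖a₀‖ + 1 := by positivity
  obtain ⟨w, hw, hvw⟩ := Metric.mem_closure_iff.1 (hs v) (ε / 2 / (C + ‖a₀‖ + 1)) (by positivity)
  obtain ⟨N, hN⟩ := Metric.tendsto_atTop.1 (hspan w hw) (ε / 2) (by positivity)
  refine ⟨N, fun n hn => ?_⟩
  have h1 := hN n hn
  rw [dist_eq_norm, ← inner_sub_left] at h1 ⊢
  rw [dist_eq_norm, lt_div_iff₀ hM] at hvw
  have h2 : ‖⟪a n - a₀, v - w⟫‖ ≤ (C + ‖a₀‖) * ‖v - w‖ :=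
    (norm_inner_le_norm _ _).trans (by
      gcongr
      exact (norm_sub_le _ _).trans (by gcongr; exact hC n))
  have h3 : ⟪a n - a₀, v⟫ = ⟪a n - a₀, w⟫ + ⟪a n - a₀, v - w⟫ := by
    rw [← inner_add_right, add_sub_cancel]
  rw [h3]
  refine (norm_add_le _ _).trans_lt ?_
  nlinarith [norm_nonneg (v - w)]

theorem nonneg_of_inner_nonneg {T : E →L[ℂ] E} (h : ∀ v, 0 ≤ ⟪v, T v⟫) : 0 ≤ T := by
  rw [ContinuousLinearMap.nonneg_iff_isPositive, ContinuousLinearMap.isPositive_iff_complex]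
  intro v
  obtain ⟨hre, him⟩ := Complex.le_def.1 (h v)
  have hsymm : ⟪T v, v⟫ = ⟪v, T v⟫ := by
    rw [← inner_conj_symm, Complex.conj_eq_iff_im]
    exact him.symm
  rw [hsymm]
  exact ⟨Complex.ext rfl him, hre⟩

variable {κ : Type*} (b : HilbertBasis κ ℂ E)

theorem hasSum_norm_inner_sq (x : E) : HasSum (fun i => ‖⟪b i, x⟫‖ ^ 2) (‖x‖ ^ 2) := by
  have h := b.hasSum_inner_mul_inner x x
  have h' := Complex.hasSum_re h
  rw [show (⟪x, x⟫).re = ‖x‖ ^ 2 from inner_self_eq_norm_sq (𝕜 := ℂ) x] at h'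
  refine h'.congr_fun fun i => ?_
  rw [← inner_conj_symm x (b i), RCLike.conj_mul]
  norm_cast

theorem summable_norm_inner_mul (x y : E) : Summable fun i => ‖⟪x, b i⟫‖ * ‖⟪b i, y⟫‖ := by
  refine Summable.of_nonneg_of_le (fun i => by positivity) (fun i => ?_)
    ((hasSum_norm_inner_sq b x).summable.add (hasSum_norm_inner_sq b y).summable)
  rw [norm_inner_symm x]
  nlinarith [sq_nonneg (‖⟪b i, x⟫‖ - ‖⟪b i, y⟫‖), sq_nonneg ‖⟪b i, x⟫‖, sq_nonneg ‖⟪b i, y⟫‖]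

/-- Cauchy–Schwarz for sums of products. -/
theorem summable_mul_and_tsum_mul_le {f g : κ → ℝ} (hf : ∀ i, 0 ≤ f i) (hg : ∀ i, 0 ≤ g i)
    (hf2 : Summable fun i => f i ^ 2) (hg2 : Summable fun i => g i ^ 2) :
    (Summable fun i => f i * g i) ∧
      ∑' i, f i * g i ≤ √(∑' i, f i ^ 2) * √(∑' i, g i ^ 2) := by
  have h := Real.summable_and_inner_le_Lp_mul_Lq_tsum_of_nonneg Real.HolderConjugate.two_two hf hg
    (by simpa using hf2) (by simpa using hg2)
  simpa [Real.sqrt_eq_rpow] using h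

theorem tsum_norm_inner_mul_le (x y : E) : ∑' i, ‖⟪x, b i⟫‖ * ‖⟪b i, y⟫‖ ≤ ‖x‖ * ‖y‖ := by
  have h := (summable_mul_and_tsum_mul_le (f := fun i => ‖⟪b i, x⟫‖) (g := fun i => ‖⟪b i, y⟫‖)
    (fun i => norm_nonneg _) (fun i => norm_nonneg _) (hasSum_norm_inner_sq b x).summable
    (hasSum_norm_inner_sq b y).summable).2
  rw [(hasSum_norm_inner_sq b x).tsum_eq, (hasSum_norm_inner_sq b y).tsum_eq,
    Real.sqrt_sq (norm_nonneg _), Real.sqrt_sq (norm_nonneg _)] at h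
  simpa only [norm_inner_symm x] using h

theorem matPos_rankOne {k : ℕ} (p : Fin k → E) : MatPos fun i j => rankOne (p i) (p j) := by
  intro v
  have : ∑ i, ∑ j, ⟪v i, rankOne (p i) (p j) (v j)⟫ =
      star (∑ i, ⟪p i, v i⟫) * ∑ j, ⟪p j, v j⟫ := by
    rw [mul_comm, star_sum, Finset.sum_mul_sum, Finset.sum_comm]
    simp [rankOne_apply]
  rw [this]
  exact star_mul_self_nonneg _

theorem isHS_rankOne (p q : E) : IsHS b (rankOne p q) := by
  have h := (hasSum_norm_inner_sq b q).summable.mul_right (‖p‖ ^ 2)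
  simpa [IsHS, rankOne_apply, norm_smul, mul_pow, norm_inner_symm q] using h

/-- The orthogonal projection onto the span of finitely many vectors of a Hilbert basis. -/
def basisProj (F : Finset κ) : E →L[ℂ] E := ∑ i ∈ F, rankOne (b i) (b i)

theorem basisProj_apply (F : Finset κ) (z : E) :
    basisProj b F z = ∑ i ∈ F, ⟪b i, z⟫ • b i := by
  simp [basisProj, rankOne_apply]

theorem basisProj_basis [DecidableEq κ] (F : Finset κ) (k : κ) :
    basisProj b F (b k) = if k ∈ F then b k else 0 := by
  simp [basisProj_apply, orthonormal_iff_ite.1 b.orthonormal]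

theorem hasNuclearRep_truncation (T : E →L[ℂ] E) (F : Finset κ) :
    HasNuclearRep (basisProj b F ∘L T ∘L basisProj b F)
      (∑ p ∈ F ×ˢ F, ‖⟪b p.1, T (b p.2)⟫‖) := by
  refine .of_hasSum (κ := ↥(F ×ˢ F)) (x := fun p => ⟪b p.1.1, T (b p.1.2)⟫ • b p.1.1)
    (y := fun p => b p.1.2) ?_ fun z => ?_
  · rw [← Finset.sum_coe_sort]
    convert hasSum_fintype _ using 3 with p
    simp [norm_smul, b.orthonormal.1]
  · rw [tsum_fintype,
      Finset.sum_coe_sort (F ×ˢ F) fun p => ⟪b p.2, z⟫ • ⟪b p.1, T (b p.2)⟫ • b p.1,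
      Finset.sum_product_right]
    simp [basisProj_apply, smul_smul, Finset.smul_sum]

variable [CompleteSpace E]

theorem hasSum_trace_of_nuclear {A T : E →L[ℂ] E} {x y : ℕ → E}
    (hc : Summable fun n => ‖x n‖ * ‖y n‖) (hT : ∀ z, T z = ∑' n, ⟪y n, z⟫ • x n) :
    HasSum (fun i => ⟪b i, A (T (b i))⟫) (∑' n, ⟪y n, A (x n)⟫) := by
  set f : ℕ × κ → ℂ := fun p => ⟪y p.1, b p.2⟫ * ⟪b p.2, A (x p.1)⟫ with hf
  have hbound : ∀ n, ‖y n‖ * ‖A (x n)‖ ≤ ‖A‖ * (‖x n‖ * ‖y n‖) := fun n => by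
    calc ‖y n‖ * ‖A (x n)‖ ≤ ‖y n‖ * (‖A‖ * ‖x n‖) := by gcongr; exact A.le_opNorm _
      _ = _ := by ring
  have hfs : Summable f := by
    refine Summable.of_norm ?_
    rw [summable_prod_of_nonneg fun p => norm_nonneg _]
    simp only [hf, norm_mul]
    refine ⟨fun n => summable_norm_inner_mul b _ _, ?_⟩
    exact Summable.of_nonneg_of_le (fun n => tsum_nonneg fun i => by positivity)
      (fun n => (tsum_norm_inner_mul_le b _ _).trans (hbound n)) (hc.mul_left ‖A‖)
  have h1 : HasSum f (∑' n, ⟪y n, A (x n)⟫) := by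
    have := (hfs.hasSum.prod_fiberwise fun n => b.hasSum_inner_mul_inner (y n) (A (x n)))
    rw [this.tsum_eq]
    exact hfs.hasSum
  have h2 : HasSum (f ∘ Prod.swap) (∑' n, ⟪y n, A (x n)⟫) :=
    (Equiv.prodComm κ ℕ).hasSum_iff.2 h1
  refine h2.prod_fiberwise fun i => ?_
  have h3 := ((innerSL ℂ (b i)).comp A).hasSum (summable_inner_smul hc (b i)).hasSum
  rw [← hT] at h3
  simpa [hf, inner_smul_right] using h3

theorem pairing_of_nuclear {A T : E →L[ℂ] E} {x y : ℕ → E}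
    (hc : Summable fun n => ‖x n‖ * ‖y n‖) (hT : ∀ z, T z = ∑' n, ⟪y n, z⟫ • x n) :
    pairing b A T = ∑' n, ⟪y n, A (x n)⟫ :=
  (hasSum_trace_of_nuclear b hc hT).tsum_eq

theorem IsTraceClass.hasSum_pairing {T : E →L[ℂ] E} (hT : IsTraceClass T) (A : E →L[ℂ] E) :
    HasSum (fun i => ⟪b i, A (T (b i))⟫) (pairing b A T) := by
  obtain ⟨x, y, hc, hT⟩ := hT
  rw [pairing_of_nuclear b hc hT]
  exact hasSum_trace_of_nuclear b hc hT

theorem pairing_sub {T S : E →L[ℂ] E} (hT : IsTraceClass T) (hS : IsTraceClass S)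
    (A : E →L[ℂ] E) : pairing b A (T - S) = pairing b A T - pairing b A S := by
  have h := (hT.hasSum_pairing b A).sub (hS.hasSum_pairing b A)
  refine HasSum.tsum_eq ?_
  simpa [inner_sub_right] using h

theorem norm_pairing_le {T : E →L[ℂ] E} (hT : IsTraceClass T) (A : E →L[ℂ] E) :
    ‖pairing b A T‖ ≤ ‖A‖ * traceNorm T := by
  have key : ∀ c, HasNuclearRep T c → ‖pairing b A T‖ ≤ ‖A‖ * c := by
    rintro c ⟨x, y, hc, hT⟩
    rw [pairing_of_nuclear b hc.summable hT]
    refine tsum_of_norm_bounded (hc.mul_left ‖A‖) fun n => ?_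
    calc ‖⟪y n, A (x n)⟫‖ ≤ ‖y n‖ * (‖A‖ * ‖x n‖) :=
          (norm_inner_le_norm _ _).trans (by gcongr; exact A.le_opNorm _)
      _ = _ := by ring
  rcases (norm_nonneg A).eq_or_lt with h0 | h0
  · obtain ⟨c, hc⟩ := isTraceClass_iff.1 hT
    simpa [← h0] using key c hc
  · rw [← div_le_iff₀' h0]
    exact le_traceNorm hT fun c hc => by
      rw [div_le_iff₀' h0]
      exact key c hc

theorem pairing_rankOne_left (T : E →L[ℂ] E) (u w : E) :
    pairing b (rankOne u w) T = ⟪w, T u⟫ := by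
  rw [← ContinuousLinearMap.adjoint_inner_left, ← b.tsum_inner_mul_inner _ u]
  simp [pairing, tr, rankOne_apply, ContinuousLinearMap.adjoint_inner_left]

theorem hasSum_norm_sq_adjoint {A : E →L[ℂ] E} {s : ℝ}
    (hA : HasSum (fun k => ‖A (b k)‖ ^ 2) s) :
    HasSum (fun k => ‖(adjoint A) (b k)‖ ^ 2) s := by
  set f : κ × κ → ℝ := fun p => ‖⟪b p.2, A (b p.1)⟫‖ ^ 2 with hf
  have hrow : ∀ k, HasSum (fun j => f (k, j)) (‖A (b k)‖ ^ 2) :=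
    fun k => hasSum_norm_inner_sq b (A (b k))
  have hfs : Summable f := by
    rw [summable_prod_of_nonneg fun p => by positivity]
    exact ⟨fun k => (hrow k).summable, by simpa only [(hrow _).tsum_eq] using hA.summable⟩
  have h1 : HasSum f s := by
    rw [← (hfs.hasSum.prod_fiberwise hrow).unique hA]
    exact hfs.hasSum
  have h2 : HasSum (f ∘ Prod.swap) s := (Equiv.prodComm κ κ).hasSum_iff.2 h1
  refine h2.prod_fiberwise fun i => ?_
  convert hasSum_norm_inner_sq b ((adjoint A) (b i)) using 3 with j
  simp [hf, ContinuousLinearMap.adjoint_inner_right, norm_inner_symm (b i)]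

theorem exists_hasNuclearRep_comp_adjoint {A B : E →L[ℂ] E} {s t : ℝ}
    (hA : HasSum (fun k => ‖A (b k)‖ ^ 2) s) (hB : HasSum (fun k => ‖B (b k)‖ ^ 2) t) :
    ∃ c ≤ √s * √t, HasNuclearRep (A ∘L adjoint B) c := by
  obtain ⟨h1, h2⟩ := summable_mul_and_tsum_mul_le (f := fun k => ‖A (b k)‖)
    (g := fun k => ‖B (b k)‖) (fun _ => norm_nonneg _) (fun _ => norm_nonneg _)
    hA.summable hB.summable
  rw [hA.tsum_eq, hB.tsum_eq] at h2
  refine ⟨_, h2, .of_hasSum h1.hasSum fun z => ?_⟩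
  have h := A.hasSum (b.hasSum_repr (adjoint B z))
  simpa [Function.comp_def, b.repr_apply_apply, ContinuousLinearMap.adjoint_inner_right]
    using h.tsum_eq.symm

theorem adjoint_basisProj (F : Finset κ) : adjoint (basisProj b F) = basisProj b F := by
  symm
  rw [ContinuousLinearMap.eq_adjoint_iff]
  intro x y
  simp only [basisProj_apply, sum_inner, inner_sum, inner_smul_left, inner_smul_right,
    inner_conj_symm]
  exact Finset.sum_congr rfl fun i _ => mul_comm _ _

theorem exists_hasNuclearRep_sub_truncation {D : E →L[ℂ] E} (hD : 0 ≤ D) {t : ℝ}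
    (ht : HasSum (fun i => (⟪b i, D (b i)⟫).re) t) (F : Finset κ) :
    ∃ c ≤ 2 * (√t * √(t - ∑ i ∈ F, (⟪b i, D (b i)⟫).re)),
      HasNuclearRep (D - basisProj b F ∘L D ∘L basisProj b F) c := by
  classical
  set S : E →L[ℂ] E := CFC.sqrt D with hSdef
  have hSS : S ∘L S = D := CFC.sqrt_mul_sqrt_self D hD
  have hSadj : adjoint S = S :=
    ((ContinuousLinearMap.nonneg_iff_isPositive S).1 (CFC.sqrt_nonneg D)).isSelfAdjoint
  have hdiag : ∀ x, (⟪x, D x⟫).re = ‖S x‖ ^ 2 := fun x => by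
    rw [← hSS, ContinuousLinearMap.comp_apply, ← ContinuousLinearMap.adjoint_inner_left, hSadj]
    exact inner_self_eq_norm_sq (𝕜 := ℂ) _
  simp only [hdiag] at ht ⊢
  set P := basisProj b F with hP
  have hPadj : adjoint P = P := adjoint_basisProj b F
  set Q : E →L[ℂ] E := 1 - P with hQ
  have hQadj : adjoint Q = Q := by
    rw [hQ, map_sub, hPadj]
    congr 1
    exact ContinuousLinearMap.adjoint_id
  have hSP : HasSum (fun k => ‖(S ∘L P) (b k)‖ ^ 2) (∑ i ∈ F, ‖S (b i)‖ ^ 2) := by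
    have : ∀ k, ‖(S ∘L P) (b k)‖ ^ 2 = if k ∈ F then ‖S (b k)‖ ^ 2 else 0 := fun k => by
      rw [ContinuousLinearMap.comp_apply, hP, basisProj_basis]
      split_ifs <;> simp
    simp only [this]
    rw [← Finset.sum_congr rfl fun k hk => if_pos hk]
    exact hasSum_sum_of_ne_finset_zero fun k hk => if_neg hk
  have hSQ : HasSum (fun k => ‖(S ∘L Q) (b k)‖ ^ 2) (t - ∑ i ∈ F, ‖S (b i)‖ ^ 2) := by
    refine (ht.sub hSP).congr_fun fun k => ?_
    simp only [hQ, ContinuousLinearMap.comp_apply, sub_apply,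
      one_apply_eq_self]
    rw [hP, basisProj_basis]
    split_ifs <;> simp
  have hPS := hasSum_norm_sq_adjoint b hSP
  have hQS := hasSum_norm_sq_adjoint b hSQ
  rw [ContinuousLinearMap.adjoint_comp, hSadj, hPadj] at hPS
  rw [ContinuousLinearMap.adjoint_comp, hSadj, hQadj] at hQS
  obtain ⟨c, hc, hcr⟩ := exists_hasNuclearRep_comp_adjoint b hQS ht
  obtain ⟨d, hd, hdr⟩ := exists_hasNuclearRep_comp_adjoint b hPS hQS
  have hle : √(∑ i ∈ F, ‖S (b i)‖ ^ 2) ≤ √t :=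
    Real.sqrt_le_sqrt (sum_le_hasSum F (fun _ _ => by positivity) ht)
  refine ⟨c + d, ?_, ?_⟩
  · nlinarith [mul_le_mul_of_nonneg_right hle (Real.sqrt_nonneg (t - ∑ i ∈ F, ‖S (b i)‖ ^ 2))]
  · convert hcr.add hdr using 1
    rw [ContinuousLinearMap.adjoint_comp, hSadj, hQadj, ← hSS]
    ext z
    simp [hQ]

/-- For positive trace class operators, entrywise convergence together with convergence of
the traces implies convergence in trace norm. -/
theorem tendsto_traceNorm_sub_of_nonneg {Dn : ℕ → E →L[ℂ] E} {D : E →L[ℂ] E}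
    (hDn : ∀ n, 0 ≤ Dn n) (hD : 0 ≤ D) (htcn : ∀ n, IsTraceClass (Dn n)) (htc : IsTraceClass D)
    (htr : Filter.Tendsto (fun n => pairing b 1 (Dn n)) Filter.atTop (nhds (pairing b 1 D)))
    (hentry : ∀ i j, Filter.Tendsto (fun n => ⟪b i, Dn n (b j)⟫) Filter.atTop
      (nhds ⟪b i, D (b j)⟫)) :
    Filter.Tendsto (fun n => traceNorm (Dn n - D)) Filter.atTop (nhds 0) := by
  set tn : ℕ → ℝ := fun n => (pairing b 1 (Dn n)).re
  set t : ℝ := (pairing b 1 D).re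
  have hsumn : ∀ n, HasSum (fun i => (⟪b i, Dn n (b i)⟫).re) (tn n) := fun n =>
    Complex.hasSum_re ((htcn n).hasSum_pairing b 1)
  have hsum : HasSum (fun i => (⟪b i, D (b i)⟫).re) t :=
    Complex.hasSum_re (htc.hasSum_pairing b 1)
  have htn : Filter.Tendsto tn Filter.atTop (nhds t) :=
    (Complex.continuous_re.tendsto _).comp htr
  have hbound : ∀ (F : Finset κ) (n : ℕ), traceNorm (Dn n - D) ≤
      ∑ p ∈ F ×ˢ F, ‖⟪b p.1, (Dn n - D) (b p.2)⟫‖ +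
        2 * (√(tn n) * √(tn n - ∑ i ∈ F, (⟪b i, Dn n (b i)⟫).re)) +
        2 * (√t * √(t - ∑ i ∈ F, (⟪b i, D (b i)⟫).re)) := by
    intro F n
    obtain ⟨c, hc, hcr⟩ := exists_hasNuclearRep_sub_truncation b (hDn n) (hsumn n) F
    obtain ⟨d, hd, hdr⟩ := exists_hasNuclearRep_sub_truncation b hD hsum F
    have h := traceNorm_le (((hasNuclearRep_truncation b (Dn n - D) F).add hcr).sub hdr)
    refine le_trans (le_of_eq ?_) (h.trans (by gcongr))
    congr 1
    ext z
    simp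
  have htail : Filter.Tendsto
      (fun F : Finset κ => 4 * (√t * √(t - ∑ i ∈ F, (⟪b i, D (b i)⟫).re)))
      Filter.atTop (nhds 0) := by
    have h : Filter.Tendsto (fun F : Finset κ => ∑ i ∈ F, (⟪b i, D (b i)⟫).re)
      Filter.atTop (nhds t) := hsum
    have := ((h.const_sub t).sqrt.const_mul √t).const_mul 4
    simpa using this
  refine (tendsto_order.2 ⟨fun ε hε => .of_forall fun n => hε.trans_le (traceNorm_nonneg _),
    fun ε hε => ?_⟩)
  obtain ⟨F, hF⟩ := (htail.eventually (gt_mem_nhds hε)).exists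
  have hdiag : Filter.Tendsto (fun n => ∑ i ∈ F, (⟪b i, Dn n (b i)⟫).re) Filter.atTop
      (nhds (∑ i ∈ F, (⟪b i, D (b i)⟫).re)) :=
    tendsto_finsetSum _ fun i _ => (Complex.continuous_re.tendsto _).comp (hentry i i)
  have hblock : Filter.Tendsto
      (fun n => ∑ p ∈ F ×ˢ F, ‖⟪b p.1, (Dn n - D) (b p.2)⟫‖) Filter.atTop (nhds 0) := by
    have h : ∀ p : κ × κ, Filter.Tendsto (fun n => ‖⟪b p.1, (Dn n - D) (b p.2)⟫‖)
        Filter.atTop (nhds 0) := fun p => by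
      simpa [inner_sub_right] using ((hentry p.1 p.2).sub_const ⟪b p.1, D (b p.2)⟫).norm
    simpa using tendsto_finsetSum (F ×ˢ F) fun p _ => h p
  have hlim := (hblock.add ((htn.sqrt.mul (htn.sub hdiag).sqrt).const_mul 2)).add_const
    (2 * (√t * √(t - ∑ i ∈ F, (⟪b i, D (b i)⟫).re)))
  refine ((tendsto_order.1 hlim).2 ε ?_).mono fun n hn => (hbound F n).trans_lt hn
  linarith

theorem norm_le_two_mul_trace {D : E →L[ℂ] E} (hD : 0 ≤ D) {t : ℝ}
    (ht : HasSum (fun i => (⟪b i, D (b i)⟫).re) t) : ‖D‖ ≤ 2 * t := by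
  obtain ⟨c, hc, h⟩ := exists_hasNuclearRep_sub_truncation b hD ht ∅
  have ht0 : 0 ≤ t := ht.nonneg fun i =>
    ((ContinuousLinearMap.nonneg_iff_isPositive D).1 hD).re_inner_nonneg_right (b i)
  simp only [basisProj, Finset.sum_empty, ContinuousLinearMap.zero_comp, sub_zero,
    Real.mul_self_sqrt ht0] at h hc
  exact h.opNorm_le.trans hc

theorem tendsto_inner_apply_of_dense_span {T : ℕ → E →L[ℂ] E} {T₀ : E →L[ℂ] E} {C : ℝ}
    (hC : ∀ n, ‖T n‖ ≤ C) {s : Set E} (hs : Dense (Submodule.span ℂ s : Set E))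
    (h : ∀ u ∈ s, ∀ v ∈ s,
      Filter.Tendsto (fun n => ⟪u, T n v⟫) Filter.atTop (nhds ⟪u, T₀ v⟫)) (u v : E) :
    Filter.Tendsto (fun n => ⟪u, T n v⟫) Filter.atTop (nhds ⟪u, T₀ v⟫) := by
  have hstar : ∀ {x y : E}, Filter.Tendsto (fun n => ⟪x, T n y⟫) Filter.atTop (nhds ⟪x, T₀ y⟫) →
      Filter.Tendsto (fun n => ⟪T n y, x⟫) Filter.atTop (nhds ⟪T₀ y, x⟫) := by
    intro x y hxy
    simpa using hxy.star
  have hright : ∀ u ∈ s, ∀ v,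
      Filter.Tendsto (fun n => ⟪u, T n v⟫) Filter.atTop (nhds ⟪u, T₀ v⟫) := by
    intro u hu v
    simp only [← ContinuousLinearMap.adjoint_inner_left]
    refine tendsto_inner_of_dense_span (C := C * ‖u‖) (fun n => ?_) hs (fun v hv => ?_) v
    · refine ((adjoint (T n)).le_opNorm u).trans ?_
      rw [LinearIsometryEquiv.norm_map]
      gcongr
      exact hC n
    · simpa only [ContinuousLinearMap.adjoint_inner_left] using h u hu v hv
  have := (tendsto_inner_of_dense_span (a := fun n => T n v) (C := C * ‖v‖)
    (fun n => (T n).le_of_opNorm_le (hC n) v) hs (fun u hu => hstar (hright u hu v)) u).star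
  simpa using this

theorem exists_norm_le_of_tendsto_inner {T : ℕ → E →L[ℂ] E} {T₀ : E →L[ℂ] E}
    (h : ∀ u v, Filter.Tendsto (fun n => ⟪u, T n v⟫) Filter.atTop (nhds ⟪u, T₀ v⟫)) :
    ∃ C, ∀ n, ‖T n‖ ≤ C := by
  refine banach_steinhaus fun v => ?_
  obtain ⟨C, hC⟩ := banach_steinhaus (g := fun n => innerSL ℂ (T n v)) fun u => by
    obtain ⟨C, hC⟩ := (h u v).norm.bddAbove_range
    exact ⟨C, fun n => by
      rw [innerSL_apply_apply, norm_inner_symm]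
      exact hC ⟨n, rfl⟩⟩
  exact ⟨C, fun n => by simpa using hC n⟩

theorem tendsto_pairing_of_tendsto_inner {T : ℕ → E →L[ℂ] E} {T₀ : E →L[ℂ] E} {C : ℝ}
    (hC : ∀ n, ‖T n‖ ≤ C)
    (h : ∀ u v, Filter.Tendsto (fun n => ⟪u, T n v⟫) Filter.atTop (nhds ⟪u, T₀ v⟫))
    {A : E →L[ℂ] E} (hA : IsTraceClass A) :
    Filter.Tendsto (fun n => pairing b (T n) A) Filter.atTop (nhds (pairing b T₀ A)) := by
  obtain ⟨x, y, hc, hA⟩ := hA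
  simp only [pairing_of_nuclear b hc hA]
  refine tendsto_tsum_of_dominated_convergence (hc.mul_left C) (fun k => h _ _)
    (.of_forall fun n k => ?_)
  calc ‖⟪y k, T n (x k)⟫‖ ≤ ‖y k‖ * (C * ‖x k‖) :=
        (norm_inner_le_norm _ _).trans (by gcongr; exact (T n).le_of_opNorm_le (hC n) _)
    _ = _ := by ring

end Hilbert

section CompletelyPositive

set_option linter.unusedSectionVars false

theorem kPos.map_nonneg {φ : (K →L[ℂ] K) →ₗ[ℂ] (K →L[ℂ] K)} (hφ : kPos 1 φ)
    {x : K →L[ℂ] K} (hx : 0 ≤ x) : 0 ≤ φ x := by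
  refine nonneg_of_inner_nonneg fun v => ?_
  have h := hφ (fun _ _ => x) fun w => by
    simpa using ((ContinuousLinearMap.nonneg_iff_isPositive x).1 hx).inner_nonneg_right (w 0)
  simpa using h fun _ => v

theorem kPos.exists_norm_le {φ : (K →L[ℂ] K) →ₗ[ℂ] (K →L[ℂ] K)} (hφ : kPos 1 φ) :
    ∃ C : ℝ, ∀ x, ‖φ x‖ ≤ C * ‖x‖ := by
  obtain ⟨C, hC⟩ := (PositiveLinearMap.mk₀ φ fun x hx => hφ.map_nonneg hx).exists_norm_apply_le
  exact ⟨C, hC⟩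

theorem exists_uniform_bound {φ : ℕ → (K →L[ℂ] K) →ₗ[ℂ] (K →L[ℂ] K)} (hφ : ∀ n, kPos 1 (φ n))
    (h : ∀ x, ∃ C, ∀ n, ‖φ n x‖ ≤ C) : ∃ C : ℝ, ∀ n x, ‖φ n x‖ ≤ C * ‖x‖ := by
  choose M hM using fun n => (hφ n).exists_norm_le
  obtain ⟨C, hC⟩ := banach_steinhaus (g := fun n => (φ n).mkContinuous (M n) (hM n)) h
  exact ⟨C, fun n x => ((φ n).mkContinuous (M n) (hM n)).le_of_opNorm_le (hC n) x⟩

end CompletelyPositive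

section Model

set_option linter.unusedSectionVars false

variable (m : HSModel e H)

/-- The vector of `H` corresponding to the rank one operator `p ⊠ q` on `K`. -/
def HSModel.rankOneVec (p q : K) : H :=
  Classical.choose ((m.mem_range (rankOne p q)).1 (isHS_rankOne e p q))

theorem HSModel.toOp_rankOneVec (p q : K) : m.toOp (m.rankOneVec p q) = rankOne p q :=
  Classical.choose_spec ((m.mem_range (rankOne p q)).1 (isHS_rankOne e p q))

theorem HSModel.inner_rankOneVec (p q : K) (x : H) :
    ⟪m.rankOneVec p q, x⟫ = ⟪p, m.toOp x q⟫ := by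
  rw [m.inner_eq, m.toOp_rankOneVec, ← ContinuousLinearMap.adjoint_inner_left,
    ← e.tsum_inner_mul_inner]
  simp [rankOne_apply, ContinuousLinearMap.adjoint_inner_left]

theorem HSModel.smul_rankOneVec (c : ℂ) (p q : K) :
    c • m.rankOneVec p q = m.rankOneVec (c • p) q := by
  apply m.inj
  ext z
  simp [m.toOp_rankOneVec, rankOne_apply, smul_comm c]

theorem HSModel.dense_span_rankOneVec :
    Dense (Submodule.span ℂ {u : H | ∃ p q, m.rankOneVec p q = u} : Set H) := by
  rw [Submodule.dense_iff_topologicalClosure_eq_top, Submodule.topologicalClosure_eq_top_iff,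
    Submodule.eq_bot_iff]
  intro x hx
  rw [Submodule.mem_orthogonal] at hx
  apply m.inj
  ext q
  rw [map_zero, zero_apply]
  refine ext_inner_left ℂ fun p => ?_
  rw [← m.inner_rankOneVec, inner_zero_right]
  exact hx _ (Submodule.subset_span ⟨p, q, rfl⟩)

theorem HSModel.exists_sum_of_mem_span {v : H}
    (hv : v ∈ Submodule.span ℂ {u : H | ∃ p q, m.rankOneVec p q = u}) :
    ∃ (k : ℕ) (p q : Fin k → K), v = ∑ i, m.rankOneVec (p i) (q i) := by
  obtain ⟨k, c, g, rfl⟩ := Submodule.mem_span_set'.1 hv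
  choose p q hpq using fun i => (g i).2
  exact ⟨k, fun i => c i • p i, q, by simp [← m.smul_rankOneVec, hpq]⟩

theorem HSModel.rankOne_rankOneVec (p q p' q' : K) :
    rankOne (m.rankOneVec p q) (m.rankOneVec p' q') =
      m.Rmul (rankOne q' q) ∘L m.Lmul (rankOne p p') := by
  ext z
  apply m.inj
  ext w
  simp [rankOne_apply, m.Rmul_eq, m.Lmul_eq, m.toOp_rankOneVec, m.inner_rankOneVec, smul_smul,
    mul_comm]

theorem HSModel.Rmul_one_comp_Lmul_one : m.Rmul 1 ∘L m.Lmul 1 = 1 := by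
  ext z
  apply m.inj
  ext w
  simp [m.Rmul_eq, m.Lmul_eq]

variable {m} {ιH : Type*} {bH : HilbertBasis ιH ℂ H} {x0 : H}
  {φ : (K →L[ℂ] K) →ₗ[ℂ] (K →L[ℂ] K)} {Φ Φst : (H →L[ℂ] H) →ₗ[ℂ] (H →L[ℂ] H)}

theorem pairing_Rmul_Lmul (hext : HSExt m φ Φ) (hnp : IsNormalPair bH Φ Φst)
    (a B : K →L[ℂ] K) :
    pairing bH (m.Rmul a ∘L m.Lmul B) (Φst (rankOne x0 x0)) =
      ⟪x0, m.Rmul a (m.Lmul (φ B) x0)⟫ := by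
  rw [← hnp.2 _ _ (isTraceClass_rankOne x0 x0), hext, pairing_rankOne_right]
  rfl

theorem pairing_Rmul_rankOne_Lmul (hext : HSExt m φ Φ) (hnp : IsNormalPair bH Φ Φst)
    (q q' : K) (B : K →L[ℂ] K) :
    pairing bH (m.Rmul (rankOne q' q) ∘L m.Lmul B) (Φst (rankOne x0 x0)) =
      ⟪m.toOp x0 q, φ B (m.toOp x0 q')⟫ := by
  rw [pairing_Rmul_Lmul hext hnp]
  have : m.Rmul (rankOne q' q) (m.Lmul (φ B) x0) = m.rankOneVec (φ B (m.toOp x0 q')) q := by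
    apply m.inj
    ext w
    simp [rankOne_apply, m.Rmul_eq, m.Lmul_eq, m.toOp_rankOneVec]
  rw [this, ← inner_conj_symm, m.inner_rankOneVec, inner_conj_symm]

theorem inner_rankOneVec_predual (hext : HSExt m φ Φ) (hnp : IsNormalPair bH Φ Φst)
    (p q p' q' : K) :
    ⟪m.rankOneVec p' q', Φst (rankOne x0 x0) (m.rankOneVec p q)⟫ =
      ⟪m.toOp x0 q, φ (rankOne p p') (m.toOp x0 q')⟫ := by
  rw [← pairing_Rmul_rankOne_Lmul hext hnp, ← m.rankOne_rankOneVec, pairing_rankOne_left]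

theorem pairing_one_predual (hext : HSExt m φ Φ) (hnp : IsNormalPair bH Φ Φst) :
    pairing bH 1 (Φst (rankOne x0 x0)) = ∑' i, ⟪m.toOp x0 (e i), φ 1 (m.toOp x0 (e i))⟫ := by
  rw [← m.Rmul_one_comp_Lmul_one, pairing_Rmul_Lmul hext hnp, m.inner_eq]
  simp [m.Rmul_eq, m.Lmul_eq]

/-- The Choi operator `D_φ` of a completely positive map is positive. -/
theorem predual_rankOne_nonneg (hext : HSExt m φ Φ) (hnp : IsNormalPair bH Φ Φst)
    (hcp : ∀ k, kPos k φ) : 0 ≤ Φst (rankOne x0 x0) := by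
  refine nonneg_of_inner_nonneg fun v => ?_
  refine m.dense_span_rankOneVec.induction (P := fun v => 0 ≤ ⟪v, Φst (rankOne x0 x0) v⟫)
    (fun v hv => ?_) ?_ v
  · obtain ⟨k, p, q, rfl⟩ := m.exists_sum_of_mem_span hv
    have h := hcp k _ (matPos_rankOne p) fun i => m.toOp x0 (q i)
    simpa only [map_sum, sum_inner, inner_sum, inner_rankOneVec_predual hext hnp] using h
  · exact isClosed_le continuous_const (by fun_prop)

theorem HSModel.dense_range_toOp (hsep : ∀ a : K →L[ℂ] K, m.Lmul a x0 = 0 → m.Lmul a = 0) :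
    Dense (Submodule.span ℂ (Set.range (m.toOp x0)) : Set K) := by
  rw [Submodule.dense_iff_topologicalClosure_eq_top, Submodule.topologicalClosure_eq_top_iff,
    Submodule.eq_bot_iff]
  intro w hw
  rw [Submodule.mem_orthogonal] at hw
  have h0 : m.Lmul (rankOne w w) = 0 := by
    refine hsep _ (m.inj ?_)
    ext z
    have : ⟪w, m.toOp x0 z⟫ = 0 := by
      rw [← inner_conj_symm, hw _ (Submodule.subset_span ⟨z, rfl⟩), map_zero]
    simp [m.Lmul_eq, rankOne_apply, this]
  have h1 := congrArg (fun T : H →L[ℂ] H => m.toOp (T (m.rankOneVec w w)) w) h0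
  simpa [m.Lmul_eq, m.toOp_rankOneVec, rankOne_apply] using h1

end Model

/-- Theorem 6.2.  Let `φₙ` and `φ` be normal completely
positive maps on `B(K)`.  The following are equivalent: (i) `{φₙ}` is
uniformly bounded and `‖φₙ − φ‖_D → 0`; (ii) `{φₙ}` is uniformly bounded,
`‖D_{φₙ}‖_{T(H)} → ‖D_φ‖_{T(H)}` and `D_{φₙ} → D_φ` weakly; (iii) `φₙ → φ` in
the point-weak* topology. -/
theorem statement16
    {K : Type*} [NormedAddCommGroup K] [InnerProductSpace ℂ K] [CompleteSpace K]
    [TopologicalSpace.SeparableSpace K]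
    {ι : Type*} (e : HilbertBasis ι ℂ K)
    {H : Type*} [NormedAddCommGroup H] [InnerProductSpace ℂ H] [CompleteSpace H]
    {ιH : Type*} (bH : HilbertBasis ιH ℂ H)
    (m : HSModel e H) (x0 : H) (hx0 : ‖x0‖ = 1)
    (hcyc : Dense {y : H | ∃ a : K →L[ℂ] K, m.Lmul a x0 = y})
    (hsep : ∀ a : K →L[ℂ] K, m.Lmul a x0 = 0 → m.Lmul a = 0)
    (φn : ℕ → (K →L[ℂ] K) →ₗ[ℂ] (K →L[ℂ] K)) (φ : (K →L[ℂ] K) →ₗ[ℂ] (K →L[ℂ] K))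
    (hnormaln : ∀ n, ∃ φst, IsNormalPair e (φn n) φst)
    (hnormal : ∃ φst, IsNormalPair e φ φst)
    (hcpn : ∀ n (j : ℕ), kPos j (φn n)) (hcp : ∀ j : ℕ, kPos j φ)
    (Φn Φstn : ℕ → (H →L[ℂ] H) →ₗ[ℂ] (H →L[ℂ] H))
    (Φ Φst : (H →L[ℂ] H) →ₗ[ℂ] (H →L[ℂ] H))
    (hextn : ∀ n, HSExt m (φn n) (Φn n)) (hnpn : ∀ n, IsNormalPair bH (Φn n) (Φstn n))
    (hext : HSExt m φ Φ) (hnp : IsNormalPair bH Φ Φst) :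
    List.TFAE [
      (∃ c : ℝ, ∀ (n : ℕ) (x : K →L[ℂ] K), ‖φn n x‖ ≤ c * ‖x‖) ∧
        Filter.Tendsto
          (fun n => traceNorm (Φstn n (rankOne x0 x0) - Φst (rankOne x0 x0)))
          Filter.atTop (nhds 0),
      (∃ c : ℝ, ∀ (n : ℕ) (x : K →L[ℂ] K), ‖φn n x‖ ≤ c * ‖x‖) ∧
        Filter.Tendsto (fun n => traceNorm (Φstn n (rankOne x0 x0)))
          Filter.atTop (nhds (traceNorm (Φst (rankOne x0 x0)))) ∧
        ∀ X : H →L[ℂ] H,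
          Filter.Tendsto (fun n => pairing bH X (Φstn n (rankOne x0 x0)))
            Filter.atTop (nhds (pairing bH X (Φst (rankOne x0 x0)))),
      ∀ B T : K →L[ℂ] K, IsTraceClass T →
        Filter.Tendsto (fun n => pairing e (φn n B) T)
          Filter.atTop (nhds (pairing e (φ B) T))] := by
  have hrank : IsTraceClass (rankOne x0 x0) := isTraceClass_rankOne x0 x0
  have htcn : ∀ n, IsTraceClass (Φstn n (rankOne x0 x0)) := fun n => (hnpn n).1 _ hrank
  have htc : IsTraceClass (Φst (rankOne x0 x0)) := hnp.1 _ hrank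
  tfae_have 1 → 2 := by
    rintro ⟨hc, hlim⟩
    refine ⟨hc, ?_, fun X => ?_⟩
    · rw [tendsto_iff_norm_sub_tendsto_zero]
      exact squeeze_zero (fun n => norm_nonneg _)
        (fun n => abs_traceNorm_sub_le (htcn n) htc) hlim
    · rw [tendsto_iff_norm_sub_tendsto_zero]
      refine squeeze_zero (fun n => norm_nonneg _) (fun n => ?_)
        (by simpa using hlim.const_mul ‖X‖)
      rw [← pairing_sub bH (htcn n) htc]
      exact norm_pairing_le bH ((htcn n).sub htc) X
  tfae_have 2 → 3 := by
    rintro ⟨⟨c, hc⟩, -, hlim⟩ B T hT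
    refine tendsto_pairing_of_tendsto_inner e (fun n => hc n B) ?_ hT
    refine tendsto_inner_apply_of_dense_span (fun n => hc n B) (m.dense_range_toOp hsep) ?_
    rintro _ ⟨q, rfl⟩ _ ⟨q', rfl⟩
    simpa only [pairing_Rmul_rankOne_Lmul hext hnp, pairing_Rmul_rankOne_Lmul (hextn _) (hnpn _)]
      using hlim (m.Rmul (rankOne q' q) ∘L m.Lmul B)
  tfae_have 3 → 1 := by
    intro hlim
    have hweak : ∀ (B : K →L[ℂ] K) (u v : K), Filter.Tendsto (fun n => ⟪u, φn n B v⟫)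
        Filter.atTop (nhds ⟪u, φ B v⟫) := fun B u v => by
      simpa only [pairing_rankOne_right] using hlim B (rankOne v u) (isTraceClass_rankOne v u)
    obtain ⟨c, hc⟩ := exists_uniform_bound (fun n => hcpn n 1)
      fun B => exists_norm_le_of_tendsto_inner (hweak B)
    refine ⟨⟨c, hc⟩, ?_⟩
    have hposn : ∀ n, 0 ≤ Φstn n (rankOne x0 x0) := fun n =>
      predual_rankOne_nonneg (hextn n) (hnpn n) (hcpn n)
    have hpos : 0 ≤ Φst (rankOne x0 x0) := predual_rankOne_nonneg hext hnp hcp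
    have htrace : Filter.Tendsto (fun n => pairing bH 1 (Φstn n (rankOne x0 x0))) Filter.atTop
        (nhds (pairing bH 1 (Φst (rankOne x0 x0)))) := by
      simp only [pairing_one_predual hext hnp, pairing_one_predual (hextn _) (hnpn _)]
      have hHS : IsHS e (m.toOp x0) := (m.mem_range _).2 ⟨x0, rfl⟩
      refine tendsto_tsum_of_dominated_convergence
        (Summable.mul_left (c * ‖(1 : K →L[ℂ] K)‖) hHS) (fun i => hweak _ _ _)
        (.of_forall fun n i => ?_)
      calc ‖⟪m.toOp x0 (e i), φn n 1 (m.toOp x0 (e i))⟫‖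
          ≤ ‖m.toOp x0 (e i)‖ * (c * ‖(1 : K →L[ℂ] K)‖ * ‖m.toOp x0 (e i)‖) :=
            (norm_inner_le_norm _ _).trans
              (by gcongr; exact (φn n 1).le_of_opNorm_le (hc n 1) _)
        _ = _ := by ring
    obtain ⟨C, hC⟩ := htrace.norm.bddAbove_range
    have hbound : ∀ n, ‖Φstn n (rankOne x0 x0)‖ ≤ 2 * C := fun n => by
      have hsum := Complex.hasSum_re ((htcn n).hasSum_pairing bH 1)
      refine (norm_le_two_mul_trace bH (hposn n) hsum).trans ?_
      gcongr
      exact (Complex.re_le_norm _).trans (hC ⟨n, rfl⟩)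
    refine tendsto_traceNorm_sub_of_nonneg bH hposn hpos htcn htc htrace fun i j => ?_
    refine tendsto_inner_apply_of_dense_span hbound m.dense_span_rankOneVec ?_ _ _
    rintro _ ⟨p', q', rfl⟩ _ ⟨p, q, rfl⟩
    simpa only [inner_rankOneVec_predual hext hnp, inner_rankOneVec_predual (hextn _) (hnpn _)]
      using hweak (rankOne p p') (m.toOp x0 q) (m.toOp x0 q')
  tfae_finish

end ChoiInf
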